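/- Let {g_α}_{α∈(0,α₀)} be an SRM with each g_α continuous on [0,‖T‖²], R_α = g_α(T*T)T*, and suppose (ρ,s) is an order-source pair for {g_α} with function h, where ρ ∈ 𝒪 and s ∈ 𝒮. Assume: (b.ii) there exists γ₁ > 0 with r_α(λ) ≥ γ₁ for all α ∈ (0,α₀) and 0 ≤ λ < h(α); and (b.iii) for each fixed λ ∈ (0,‖T‖²], α ↦ |r_α(λ)| is non-decreasing. Let φ : (0,∞) → (0,∞) be continuous, non-decreasing, with lim_{δ→0⁺} φ(δ) = 0, and let x* ∈ X, x* ≠ 0. If e(x*,δ) = O(φ(δ)) as δ → 0⁺, then there exists an a-priori parameter choice rule α̃ : (0,∞) → (0,α₀) with lim_{δ→0⁺} α̃(δ) = 0 such that sup{‖R_{α̃(δ)} y − x*‖ : ‖Tx* − y‖ ≤ δ} = O(φ(δ)) as δ → 0⁺. -/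

import Mathlib

open Filter Topology Set Asymptotics

noncomputable section

/-- `ρ ∈ 𝒪`: non-decreasing, positive on `(0,∞)`, with `ρ(α) → 0` as `α → 0⁺`. -/
def MemO (ρ : ℝ → ℝ) : Prop :=
  (∀ α > (0:ℝ), 0 < ρ α) ∧ (∀ a b : ℝ, 0 < a → a ≤ b → ρ a ≤ ρ b) ∧
    Tendsto ρ (𝓝[>] (0:ℝ)) (𝓝 0)

/-- `s ∈ 𝒮`: continuous on `[0,∞)`, `s 0 = 0`, nonnegative, positive on `(0,∞)`. -/
def MemS (s : ℝ → ℝ) : Prop :=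
  ContinuousOn s (Ici (0:ℝ)) ∧ s 0 = 0 ∧ (∀ t, 0 ≤ t → 0 ≤ s t) ∧ (∀ t, 0 < t → 0 < s t)

/-- Spectral regularization method on `[0,Λ]` (hypotheses H2, H3). -/
def IsSRM (α₀ Λ : ℝ) (g : ℝ → ℝ → ℝ) : Prop :=
  (∃ C > (0:ℝ), ∀ α ∈ Ioo (0:ℝ) α₀, ∀ lam ∈ Icc (0:ℝ) Λ, |lam * g α lam| ≤ C) ∧
  (∀ lam ∈ Ioc (0:ℝ) Λ, Tendsto (fun α => g α lam) (𝓝[>] (0:ℝ)) (𝓝 (1 / lam)))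

/-- `(s,ρ)` is a weak source-order pair: `limsup_{α→0⁺} s(λ)|r_α(λ)|/ρ(α) < ∞` for `λ ∈ (0,Λ]`. -/
def WeakSourceOrderPair (Λ : ℝ) (g : ℝ → ℝ → ℝ) (s ρ : ℝ → ℝ) : Prop :=
  ∀ lam ∈ Ioc (0:ℝ) Λ,
    Filter.limsup (fun α => ((s lam * |1 - lam * g α lam| / ρ α : ℝ) : EReal)) (𝓝[>] (0:ℝ)) < ⊤

/-- `(s,ρ)` is a strong source-order pair: weak, and the `limsup` is `> 0` for every `λ ∈ (0,Λ]`. -/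
def StrongSourceOrderPair (Λ : ℝ) (g : ℝ → ℝ → ℝ) (s ρ : ℝ → ℝ) : Prop :=
  WeakSourceOrderPair Λ g s ρ ∧
  ∀ lam ∈ Ioc (0:ℝ) Λ,
    0 < Filter.limsup (fun α => ((s lam * |1 - lam * g α lam| / ρ α : ℝ) : EReal)) (𝓝[>] (0:ℝ))

/-- `(ρ,s)` is an order-source pair: `∃ γ > 0` and `h → 0` with
`s(λ)|r_α(λ)| ≥ γ ρ(α)` for all `α ∈ (0,α₀)` and `λ ∈ [h(α),Λ]`. -/
def OrderSourcePair (α₀ Λ : ℝ) (g : ℝ → ℝ → ℝ) (ρ s : ℝ → ℝ) : Prop :=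
  ∃ γ > (0:ℝ), ∃ h : ℝ → ℝ, (∀ α ∈ Ioo (0:ℝ) α₀, 0 < h α) ∧
    Tendsto h (𝓝[>] (0:ℝ)) (𝓝 0) ∧
    ∀ α ∈ Ioo (0:ℝ) α₀, ∀ lam ∈ Icc (h α) Λ, γ * ρ α ≤ s lam * |1 - lam * g α lam|

/-- `ρ` is an optimal qualification of `{g_α}`. -/
def OptimalQualification (α₀ Λ : ℝ) (g : ℝ → ℝ → ℝ) (ρ : ℝ → ℝ) : Prop :=
  ∃ s : ℝ → ℝ, MemS s ∧ StrongSourceOrderPair Λ g s ρ ∧ OrderSourcePair α₀ Λ g ρ s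

variable {X Y : Type*} [NormedAddCommGroup X] [InnerProductSpace ℂ X] [CompleteSpace X]
  [NormedAddCommGroup Y] [InnerProductSpace ℂ Y] [CompleteSpace Y]

/-- The spectral regularization operators `R_α = g_α(T*T) T*`. -/
noncomputable def Rop (g : ℝ → ℝ → ℝ) (T : X →L[ℂ] Y) (α : ℝ) : Y →L[ℂ] X :=
  (cfc (g α) ((ContinuousLinearMap.adjoint T).comp T)).comp (ContinuousLinearMap.adjoint T)

/-- The total error `e(x,δ) = inf_{α∈(0,α₀)} sup_{‖Tx-y‖≤δ} ‖R_α y - x‖`. -/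
noncomputable def totErr (α₀ : ℝ) (T : X →L[ℂ] Y) (R : ℝ → Y →L[ℂ] X) (x : X) (δ : ℝ) : ℝ :=
  ⨅ α : Ioo (0:ℝ) α₀, ⨆ y : {y : Y // ‖T x - y‖ ≤ δ}, ‖R α.1 y.1 - x‖

/-- If `m ≤ |f|` on the spectrum of a selfadjoint operator `A`, then `f(A)` is bounded below
by `m`. -/
theorem mul_norm_le_norm_cfc_apply (A : X →L[ℂ] X) (hA : IsSelfAdjoint A) (f : ℝ → ℝ)
    (hf : ContinuousOn f (spectrum ℝ A)) {m : ℝ} (hm : 0 < m)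
    (hmf : ∀ t ∈ spectrum ℝ A, m ≤ |f t|) (x : X) : m * ‖x‖ ≤ ‖cfc f A x‖ := by
  have hne : ∀ t ∈ spectrum ℝ A, f t ≠ 0 := fun t ht =>
    abs_pos.mp (hm.trans_le (hmf t ht))
  have hinv : ContinuousOn (fun t => (f t)⁻¹) (spectrum ℝ A) := hf.inv₀ hne
  have hone : cfc (fun t => (f t)⁻¹) A * cfc f A = 1 := by
    rw [← cfc_mul (fun t => (f t)⁻¹) f A hinv hf, ← cfc_one ℝ A]
    exact cfc_congr fun t ht => inv_mul_cancel₀ (hne t ht)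
  have hnorm : ‖cfc (fun t => (f t)⁻¹) A‖ ≤ m⁻¹ := by
    refine norm_cfc_le (inv_nonneg.mpr hm.le) fun t ht => ?_
    rw [norm_inv, Real.norm_eq_abs]
    exact inv_anti₀ hm (hmf t ht)
  have hx : cfc (fun t => (f t)⁻¹) A (cfc f A x) = x := by
    simpa using congrArg (fun B : X →L[ℂ] X => B x) hone
  have hle : ‖x‖ ≤ m⁻¹ * ‖cfc f A x‖ := by
    calc ‖x‖ = ‖cfc (fun t => (f t)⁻¹) A (cfc f A x)‖ := by rw [hx]
      _ ≤ ‖cfc (fun t => (f t)⁻¹) A‖ * ‖cfc f A x‖ := ContinuousLinearMap.le_opNorm _ _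
      _ ≤ m⁻¹ * ‖cfc f A x‖ := by gcongr
  calc m * ‖x‖ ≤ m * (m⁻¹ * ‖cfc f A x‖) := by gcongr
    _ = ‖cfc f A x‖ := mul_inv_cancel_left₀ hm.ne' _

theorem isSelfAdjoint_adjoint_comp (T : X →L[ℂ] Y) :
    IsSelfAdjoint ((ContinuousLinearMap.adjoint T).comp T) :=
  (ContinuousLinearMap.isPositive_adjoint_comp_self T).isSelfAdjoint

theorem spectrum_adjoint_comp_subset (T : X →L[ℂ] Y) :
    spectrum ℝ ((ContinuousLinearMap.adjoint T).comp T) ⊆ Icc 0 (‖T‖ ^ 2) := by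
  intro t ht
  constructor
  · have hpos : 0 ≤ (ContinuousLinearMap.adjoint T).comp T :=
      (ContinuousLinearMap.nonneg_iff_isPositive _).mpr
        (ContinuousLinearMap.isPositive_adjoint_comp_self T)
    exact spectrum_nonneg_of_nonneg hpos ht
  · rcases subsingleton_or_nontrivial X with hX | hX
    · have : Subsingleton (X →L[ℂ] X) := ⟨fun a b => by ext v; exact Subsingleton.elim _ _⟩
      simp [spectrum.of_subsingleton] at ht
    · have hn : ‖t‖ ≤ ‖(ContinuousLinearMap.adjoint T).comp T‖ :=
        spectrum.norm_le_norm_of_mem ht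
      rw [ContinuousLinearMap.norm_adjoint_comp_self, ← sq] at hn
      exact (le_abs_self t).trans hn

/-- On exact data the error of `R_α` is the residual operator `r_α(T*T)` applied to `x`. -/
theorem norm_Rop_apply_sub (T : X →L[ℂ] Y) (g : ℝ → ℝ → ℝ) (α : ℝ)
    (hg : ContinuousOn (g α) (Icc (0:ℝ) (‖T‖ ^ 2))) (x : X) :
    ‖Rop g T α (T x) - x‖
      = ‖cfc (fun t => 1 - t * g α t) ((ContinuousLinearMap.adjoint T).comp T) x‖ := by
  set A := (ContinuousLinearMap.adjoint T).comp T with hA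
  have hsa : IsSelfAdjoint A := isSelfAdjoint_adjoint_comp T
  have hgs : ContinuousOn (g α) (spectrum ℝ A) := hg.mono (spectrum_adjoint_comp_subset T)
  have hcfc : cfc (fun t => 1 - t * g α t) A = 1 - cfc (g α) A * A := by
    rw [cfc_sub (fun _ => (1:ℝ)) (fun t => t * g α t) A, cfc_const_one ℝ A]
    congr 1
    simp_rw [mul_comm _ (g α _)]
    rw [cfc_mul (g α) (fun t => t) A, cfc_id' ℝ A]
  rw [hcfc, ← norm_neg]
  congr 1
  simp [Rop, A]

theorem bddAbove_range_norm_apply_sub (T : X →L[ℂ] Y) (R : Y →L[ℂ] X) (x : X) (δ : ℝ) :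
    BddAbove (range fun y : {y : Y // ‖T x - y‖ ≤ δ} => ‖R y.1 - x‖) := by
  refine ⟨‖R (T x) - x‖ + ‖R‖ * δ, ?_⟩
  rintro _ ⟨⟨y, hy⟩, rfl⟩
  calc ‖R y - x‖ = ‖(R (T x) - x) - R (T x - y)‖ := by rw [map_sub]; congr 1; abel
    _ ≤ ‖R (T x) - x‖ + ‖R (T x - y)‖ := norm_sub_le _ _
    _ ≤ ‖R (T x) - x‖ + ‖R‖ * δ := by
      gcongr
      exact (R.le_opNorm _).trans (by gcongr)

/-- under (b.ii), (b.iii) and an order-source pair `(ρ,s)`, if the total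
error at `x* ≠ 0` is `O(φ(δ))` as `δ → 0⁺`, then there is an a-priori parameter
choice rule `α̃(δ) ∈ (0,α₀)` with `α̃(δ) → 0` realizing the same `O(φ(δ))` bound for
the worst-case error. -/
theorem stmt6 (T : X →L[ℂ] Y) (hT : ¬ IsClosed (Set.range T))
    (α₀ : ℝ) (hα₀ : 0 < α₀) (g : ℝ → ℝ → ℝ) (hg : IsSRM α₀ (‖T‖^2) g)
    (hgc : ∀ α ∈ Ioo (0:ℝ) α₀, ContinuousOn (g α) (Icc (0:ℝ) (‖T‖^2)))
    (ρ s : ℝ → ℝ) (hρ : MemO ρ) (hs : MemS s)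
    (γ : ℝ) (hγ : 0 < γ) (h : ℝ → ℝ) (hhpos : ∀ α ∈ Ioo (0:ℝ) α₀, 0 < h α)
    (hh0 : Tendsto h (𝓝[>] (0:ℝ)) (𝓝 0))
    (hos : ∀ α ∈ Ioo (0:ℝ) α₀, ∀ lam ∈ Icc (h α) (‖T‖^2),
      γ * ρ α ≤ s lam * |1 - lam * g α lam|)
    (γ₁ : ℝ) (hγ₁ : 0 < γ₁)
    (hbii : ∀ α ∈ Ioo (0:ℝ) α₀, ∀ lam : ℝ, 0 ≤ lam → lam < h α → γ₁ ≤ 1 - lam * g α lam)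
    (hbiii : ∀ lam ∈ Ioc (0:ℝ) (‖T‖^2), ∀ a b : ℝ, a ∈ Ioo (0:ℝ) α₀ → b ∈ Ioo (0:ℝ) α₀ →
      a ≤ b → |1 - lam * g a lam| ≤ |1 - lam * g b lam|)
    (φ : ℝ → ℝ) (hφc : ContinuousOn φ (Ioi (0:ℝ))) (hφpos : ∀ δ > (0:ℝ), 0 < φ δ)
    (hφmono : ∀ a b : ℝ, 0 < a → a ≤ b → φ a ≤ φ b)
    (hφ0 : Tendsto φ (𝓝[>] (0:ℝ)) (𝓝 0))
    (x : X) (hx : x ≠ 0)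
    (he : (fun δ => totErr α₀ T (Rop g T) x δ) =O[𝓝[>] (0:ℝ)] φ) :
    ∃ αp : ℝ → ℝ, (∀ δ > (0:ℝ), αp δ ∈ Ioo (0:ℝ) α₀) ∧
      Tendsto αp (𝓝[>] (0:ℝ)) (𝓝 0) ∧
      (fun δ => ⨆ y : {y : Y // ‖T x - y‖ ≤ δ}, ‖Rop g T (αp δ) y.1 - x‖)
        =O[𝓝[>] (0:ℝ)] φ := by
  have : Nonempty (Ioo (0:ℝ) α₀) := ⟨⟨α₀ / 2, by constructor <;> linarith⟩⟩
  have hex : ∀ δ : ℝ, ∃ α : Ioo (0:ℝ) α₀, 0 < δ →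
      (⨆ y : {y : Y // ‖T x - y‖ ≤ δ}, ‖Rop g T α.1 y.1 - x‖)
        < totErr α₀ T (Rop g T) x δ + φ δ := by
    intro δ
    by_cases hδ : 0 < δ
    · obtain ⟨α, hα⟩ := exists_lt_of_ciInf_lt
        (lt_add_of_pos_right (totErr α₀ T (Rop g T) x δ) (hφpos δ hδ))
      exact ⟨α, fun _ => hα⟩
    · exact ⟨Classical.arbitrary _, fun h => absurd h hδ⟩
  choose αp hαp using hex
  obtain ⟨C, hC⟩ := he.bound
  have hbound : ∀ᶠ δ in 𝓝[>] (0:ℝ),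
      (⨆ y : {y : Y // ‖T x - y‖ ≤ δ}, ‖Rop g T (αp δ).1 y.1 - x‖) ≤ (C + 1) * φ δ := by
    filter_upwards [hC, self_mem_nhdsWithin] with δ hδ hδ0
    have h1 := hαp δ hδ0
    rw [Real.norm_of_nonneg (hφpos δ hδ0).le] at hδ
    have h2 := (Real.le_norm_self _).trans hδ
    linarith
  refine ⟨fun δ => (αp δ).1, fun δ _ => (αp δ).2, ?_, ?_⟩
  · rw [tendsto_order]
    refine ⟨fun a ha => Eventually.of_forall fun δ => ha.trans (αp δ).2.1, fun ε hε => ?_⟩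
    by_cases hεα : ε < α₀
    swap
    · exact Eventually.of_forall fun δ => (αp δ).2.2.trans_le (not_lt.mp hεα)
    have hεm : ε ∈ Ioo (0:ℝ) α₀ := ⟨hε, hεα⟩
    have hres : ∀ α ∈ Ioo (0:ℝ) α₀,
        ContinuousOn (fun t => 1 - t * g α t) (Icc (0:ℝ) (‖T‖ ^ 2)) := fun α hα =>
      continuousOn_const.sub (continuousOn_id.mul (hgc α hα))
    have hne : ∀ t ∈ Icc (0:ℝ) (‖T‖ ^ 2), 0 < |1 - t * g ε t| := by
      intro t ht
      rcases lt_or_ge t (h ε) with hlt | hge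
      · exact abs_pos.mpr (hγ₁.trans_le (hbii ε hεm t ht.1 hlt)).ne'
      · have hpos := (mul_pos hγ (hρ.1 ε hε)).trans_le (hos ε hεm t ⟨hge, ht.2⟩)
        exact pos_of_mul_pos_right hpos (hs.2.2.1 t ht.1)
    obtain ⟨t₀, ht₀, hmin⟩ := isCompact_Icc.exists_isMinOn
      (nonempty_Icc.mpr (sq_nonneg ‖T‖)) (hres ε hεm).abs
    have hm := hne t₀ ht₀
    have hlow : ∀ α ∈ Ioo (0:ℝ) α₀, ε ≤ α →
        |1 - t₀ * g ε t₀| * ‖x‖ ≤ ‖Rop g T α (T x) - x‖ := by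
      intro α hα hle
      rw [norm_Rop_apply_sub T g α (hgc α hα) x]
      refine mul_norm_le_norm_cfc_apply _ (isSelfAdjoint_adjoint_comp T) _
        ((hres α hα).mono (spectrum_adjoint_comp_subset T)) hm (fun t ht => ?_) x
      have ht' := spectrum_adjoint_comp_subset T ht
      refine (isMinOn_iff.mp hmin t ht').trans ?_
      rcases ht'.1.eq_or_lt with h0 | h0
      · simp [← h0]
      · exact hbiii t ⟨h0, ht'.2⟩ ε α hεm hα hle
    have hlim : Tendsto (fun δ => (C + 1) * φ δ) (𝓝[>] (0:ℝ)) (𝓝 0) := by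
      simpa using hφ0.const_mul (C + 1)
    filter_upwards [hbound, self_mem_nhdsWithin,
      hlim.eventually_lt_const (mul_pos hm (norm_pos_iff.mpr hx))] with δ hδ hδ0 hsmall
    by_contra! hcon
    have h1 := hlow _ (αp δ).2 hcon
    have h2 := le_ciSup (bddAbove_range_norm_apply_sub T (Rop g T (αp δ).1) x δ)
      ⟨T x, by simpa using (mem_Ioi.mp hδ0).le⟩
    exact absurd (h1.trans (h2.trans hδ)) (not_le.mpr hsmall)
  · refine IsBigO.of_bound (C + 1) ?_
    filter_upwards [hbound, self_mem_nhdsWithin] with δ hδ hδ0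
    rwa [Real.norm_of_nonneg (Real.iSup_nonneg fun _ => norm_nonneg _),
      Real.norm_of_nonneg (hφpos δ hδ0).le]
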